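/- The elements v_i := p·x_i·y_i⁻¹ and v_j := p·x_j·y_j⁻¹ satisfy [v_j, v_i] = ((q²−1)/(q²+1))·( v_j² − v_i² − λ·(v_i − v_j)² ), where μ := μ⁽¹⁾/μ⁽²⁾ and λ := (q² − 2qμ + 1)/(1 − q²). -/

import Mathlib

/-- Lemma 9: in the algebra of noncommutative projective coordinates, the
elements `v_i = p·x_i·y_i⁻¹` and `v_j = p·x_j·y_j⁻¹` satisfy the defining
relation of `A_λ` with `λ = (q² − 2qμ + 1)/(1 − q²)`, `μ = μ⁽¹⁾/μ⁽²⁾`. -/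
theorem projective_coordinates_give_relation {R : Type*} [Ring R] [Algebra ℂ R]
    (p q μ1 μ2 μ lam : ℂ) (hq : q = p ^ 2) (hq0 : q ≠ 0)
    (hq1 : q ^ 2 ≠ 1) (hq2 : q ^ 2 ≠ -1) (hμ1 : μ1 ≠ 0) (hμ2 : μ2 ≠ 0)
    (hμ : μ = μ1 / μ2) (hlam : lam = (q ^ 2 - 2 * q * μ + 1) / (1 - q ^ 2))
    (xi xj : R) (yi yj : Rˣ)
    (hxiyi : xi * (yi : R) = q • ((yi : R) * xi))
    (hxjyj : xj * (yj : R) = q • ((yj : R) * xj))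
    (hxjxi : xj * xi = μ1 • (xi * xj))
    (hyjyi : (yj : R) * (yi : R) = μ1 • ((yi : R) * (yj : R)))
    (hxjyi : xj * (yi : R) = μ2 • ((yi : R) * xj) + (μ1 - q⁻¹ * μ2) • (xi * (yj : R)))
    (hyjxi : (yj : R) * xi = μ2 • (xi * (yj : R)) + (μ1 - q * μ2) • ((yi : R) * xj))
    (vi vj : R) (hvi : vi = p • (xi * (↑yi⁻¹ : R))) (hvj : vj = p • (xj * (↑yj⁻¹ : R))) :
    vj * vi - vi * vj =
      ((q ^ 2 - 1) / (q ^ 2 + 1)) • (vj ^ 2 - vi ^ 2 - lam • (vi - vj) ^ 2) := by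
  have hμ0 : μ ≠ 0 := by rw [hμ]; exact div_ne_zero hμ1 hμ2
  have hμ12 : μ1 = μ * μ2 := by rw [hμ]; field_simp
  have hd1 : (1 : ℂ) - q ^ 2 ≠ 0 := fun h => hq1 (by linear_combination -h)
  have hd2 : q ^ 2 + 1 ≠ 0 := fun h => hq2 (by linear_combination h)
  obtain ⟨a, ha⟩ : ∃ a : R, a = xi * (↑yi⁻¹ : R) := ⟨_, rfl⟩
  obtain ⟨b, hb⟩ : ∃ b : R, b = xj * (↑yj⁻¹ : R) := ⟨_, rfl⟩
  have hxi : xi = a * yi := by rw [ha, Units.inv_mul_cancel_right]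
  have hxj : xj = b * yj := by rw [hb, Units.inv_mul_cancel_right]
  rw [← ha] at hvi
  rw [← hb] at hvj
  clear ha hb
  subst hxi hxj
  -- move `yi` past `b`
  have h1 : (yi : R) * b = (μ • b - μ • a + q⁻¹ • a) * yi := by
    apply (Units.mul_left_inj yj).1
    have e : b * (yj : R) * yi = μ1 • (b * (yi * yj)) := by
      rw [mul_assoc, hyjyi, mul_smul_comm]
    rw [e] at hxjyi
    have h := congrArg (fun t => μ2⁻¹ • t) hxjyi
    simp only [mul_assoc, add_mul, sub_mul, smul_mul_assoc, hμ12] at h ⊢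
    linear_combination (norm := skip) -h
    match_scalars <;> field_simp <;> ring
  have h2 : (yj : R) * a = ((μ - q) • b - (μ - q) • a + q⁻¹ • a) * yj := by
    apply (Units.mul_left_inj yi).1
    rw [← mul_assoc, ← mul_assoc, h1] at hyjxi
    rw [hyjxi, mul_assoc _ (yj : R) (yi : R), hyjyi]
    simp only [mul_assoc, add_mul, sub_mul, smul_mul_assoc, mul_smul_comm, hμ12]
    match_scalars <;> field_simp <;> ring
  have h3 : b * ((μ - q) • b - (μ - q) • a + q⁻¹ • a)
      = a * (μ • b - μ • a + q⁻¹ • a) := by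
    apply (Units.mul_left_inj (yj * yi)).1
    have e1 : b * (yj : R) * (a * yi)
        = b * ((μ - q) • b - (μ - q) • a + q⁻¹ • a) * (yj * yi) := by
      rw [mul_assoc b, ← mul_assoc (yj : R), h2]; simp only [mul_assoc]
    have e2 : μ1 • (a * (yi : R) * (b * yj))
        = a * (μ • b - μ • a + q⁻¹ • a) * (yj * yi) := by
      rw [mul_assoc a, ← mul_assoc (yi : R), h1, hyjyi, mul_smul_comm]
      simp only [mul_assoc]
    rw [Units.val_mul, ← e1, ← e2]
    exact hxjxi
  have h4 : p * p = q := by rw [hq]; ring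
  rw [hvi, hvj, hlam]
  simp only [pow_two (_ : R), mul_add, mul_sub, sub_mul, smul_mul_assoc, mul_smul_comm,
    smul_smul, h4] at h3 ⊢
  linear_combination (norm := skip) (2 * q ^ 2 / (q ^ 2 + 1)) • h3
  have hd3 : 1 + q ^ 2 ≠ 0 := by rwa [add_comm]
  have hp0 : p ≠ 0 := by rintro rfl; exact hq0 (by rw [hq]; ring)
  match_scalars <;> field_simp <;> subst hq <;> ring
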